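/- arXiv:2212.02249 — 3 statements merged into one kernel-verified Lean document; each statement's English description precedes it below -/
import Mathlib

section
/- Let p be a prime and m ≥ 1 an integer. Every abelian subgroup E of GL_{m+1}(F_p) whose order is a power of p satisfies |E| ≤ p^{⌊(m+1)²/4⌋}. (Upper-bound part of the Goozeff–Barry theorem, Theorem 9.1 of the paper.) -/
open Module

namespace Representation

universe u

/-- A `p`-group acting linearly on a nonzero finite vector space over `𝔽_p` fixes a nonzero
vector. -/
theorem exists_ne_zero_forall_apply_eq_self {p : ℕ} [Fact p.Prime] {G : Type*} [Group G]
    (hG : IsPGroup p G) {V : Type*} [AddCommGroup V] [Module (ZMod p) V]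
    [Module.Finite (ZMod p) V] [Nontrivial V] (ρ : Representation (ZMod p) G V) :
    ∃ v : V, v ≠ 0 ∧ ∀ g, ρ g v = v := by
  have : Finite V := Module.finite_of_finite (ZMod p)
  let _ : MulAction G V := MulAction.compHom V ρ
  have hcard : p ∣ Nat.card V := by
    rw [Module.natCard_eq_pow_finrank (K := ZMod p), Nat.card_zmod]
    exact dvd_pow_self p (finrank_pos (R := ZMod p) (M := V)).ne'
  have h0 : (0 : V) ∈ MulAction.fixedPoints G V := fun g => map_zero (ρ g)
  obtain ⟨v, hv, hne⟩ :=
    hG.exists_fixed_point_of_prime_dvd_card_of_fixed_point V hcard h0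
  exact ⟨v, hne.symm, hv⟩

/-- If a subgroup acts through a set of operators parametrized by a finite type `D`, then its
order is at most `|D|` times the order of the kernel. -/
theorem card_subgroup_le {k G V D : Type*} [CommSemiring k] [Group G] [Finite G]
    [AddCommMonoid V] [Module k V] [Finite D] (ρ : Representation k G V) (H : Subgroup G)
    (F : D → V →ₗ[k] V) (hF : ∀ g ∈ H, ∃ d, F d = ρ g) :
    Nat.card H ≤ Nat.card D * Nat.card ρ.ker := by
  choose c hc using hF
  let r : H →* (V →ₗ[k] V) := ρ.comp H.subtype
  have hker : Nat.card r.ker ≤ Nat.card ρ.ker :=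
    Nat.card_le_card_of_injective (fun x => (⟨x.1.1, x.2⟩ : ρ.ker)) fun x y h =>
      Subtype.ext (Subtype.ext (Subtype.mk.inj h))
  have hquot : Nat.card (H ⧸ r.ker) ≤ Nat.card D := by
    refine Nat.card_le_card_of_injective (fun x => c x.out.1 x.out.2) fun x y h => ?_
    have h1 : r x.out = r y.out :=
      (hc x.out.1 x.out.2).symm.trans ((congrArg F h).trans (hc y.out.1 y.out.2))
    rw [← QuotientGroup.out_eq' x, ← QuotientGroup.out_eq' y]
    refine QuotientGroup.eq.2 ?_
    rw [MonoidHom.mem_ker, map_mul, ← h1, ← map_mul, inv_mul_cancel, map_one]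
  rw [Subgroup.card_eq_card_quotient_mul_card_subgroup r.ker]
  exact Nat.mul_le_mul hquot hker

/-- If `G` is commutative, `v` spans a `G`-stable line and `φ` is a functional with `G`-stable kernel
such that `φ v = 0`, then the kernels of the actions on `V / ⟨v⟩` and on `ker φ` cannot both be large. -/
theorem card_ker_quotient_le_or_card_ker_subrepresentation_le {p : ℕ} [Fact p.Prime]
    {G : Type*} [CommGroup G] [Finite G] {V : Type*} [AddCommGroup V] [Module (ZMod p) V]
    [Module.Finite (ZMod p) V] (ρ : Representation (ZMod p) G V) {v : V} (hv : v ≠ 0)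
    {φ : Dual (ZMod p) V} (hφ : φ ≠ 0) (hφv : φ v = 0)
    (hL : ∀ g, Submodule.span (ZMod p) {v} ≤ (Submodule.span (ZMod p) {v}).comap (ρ g))
    (hH : ∀ g, LinearMap.ker φ ≤ (LinearMap.ker φ).comap (ρ g)) :
    Nat.card (ρ.quotient _ hL).ker ≤ p ^ (finrank (ZMod p) V / 2) * Nat.card ρ.ker ∨
    Nat.card (ρ.subrepresentation _ hH).ker ≤ p ^ (finrank (ZMod p) V / 2) * Nat.card ρ.ker := by
  have hp : 0 < p := (Fact.out : p.Prime).pos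
  set K₁ := (ρ.quotient _ hL).ker
  set K₂ := (ρ.subrepresentation _ hH).ker
  have hK₂fix : ∀ h ∈ K₂, ∀ x, φ x = 0 → ρ h x = x := fun h hh x hx =>
    congrArg Subtype.val (LinearMap.congr_fun (MonoidHom.mem_ker.1 hh)
      (⟨x, hx⟩ : LinearMap.ker φ))
  let D : Submodule (ZMod p) (Dual (ZMod p) V) :=
    Submodule.span (ZMod p) {f | ∃ g ∈ K₁, ∀ x, ρ g x = x + f x • v}
  have hdim := Subspace.finrank_add_finrank_dualCoannihilator_eq D
  have : Finite V := Module.finite_of_finite (ZMod p)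
  have : Finite (Dual (ZMod p) V) := Module.finite_of_finite (ZMod p)
  have hD₁ : Nat.card K₁ ≤ Nat.card D * Nat.card ρ.ker := by
    refine card_subgroup_le ρ K₁ (fun f => LinearMap.id + (f : Dual (ZMod p) V).smulRight v) ?_
    intro g hg
    obtain ⟨θ, hθ⟩ := Module.Projective.exists_dual_eq_one (ZMod p) hv
    have hf : ∀ x, ρ g x = x + θ (ρ g x - x) • v := by
      intro x
      have hx : ρ g x - x ∈ Submodule.span (ZMod p) {v} :=
        (Submodule.Quotient.eq _).1 (LinearMap.congr_fun (MonoidHom.mem_ker.1 hg)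
          (Submodule.Quotient.mk x))
      obtain ⟨a, ha⟩ := Submodule.mem_span_singleton.1 hx
      rw [← ha, map_smul, hθ, smul_eq_mul, mul_one, ha, add_sub_cancel]
    refine ⟨⟨θ ∘ₗ (ρ g - LinearMap.id), Submodule.subset_span ⟨g, hg, fun x => ?_⟩⟩, ?_⟩
    · simpa using hf x
    · ext x
      simpa using (hf x).symm
  have hD₂ : Nat.card K₂ ≤ Nat.card D.dualCoannihilator * Nat.card ρ.ker := by
    refine card_subgroup_le ρ K₂ (fun w => LinearMap.id + φ.smulRight (w : V)) ?_
    intro h hh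
    obtain ⟨u, hu⟩ : ∃ u, φ u = 1 := by
      obtain ⟨x, hx⟩ := DFunLike.ne_iff.1 hφ
      exact ⟨(φ x)⁻¹ • x, by simpa using inv_mul_cancel₀ hx⟩
    refine ⟨⟨ρ h u - u, ?_⟩, ?_⟩
    · rw [Submodule.mem_dualCoannihilator]
      intro f hf
      induction hf using Submodule.span_induction with
      | zero => rfl
      | add f₁ f₂ _ _ h₁ h₂ => simp [-map_sub, h₁, h₂]
      | smul a f _ h₁ => simp [-map_sub, h₁]
      | mem f hf =>
        obtain ⟨g, hg, hgf⟩ := hf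
        have hcomm : ρ g (ρ h u) = ρ h (ρ g u) := by
          rw [← Module.End.mul_apply, ← Module.End.mul_apply, ← map_mul, ← map_mul, mul_comm]
        rw [hgf, hgf, map_add, map_smul, hK₂fix h hh v hφv] at hcomm
        have h2 := smul_left_injective (ZMod p) hv (add_left_cancel hcomm)
        rw [map_sub, h2, sub_self]
    · ext x
      have hx := hK₂fix h hh (x - φ x • u) (by simp [hu])
      rw [map_sub, map_smul, sub_eq_iff_eq_add] at hx
      simp only [LinearMap.add_apply, LinearMap.id_apply, LinearMap.smulRight_apply]
      rw [hx, smul_sub]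
      abel
  rw [Module.natCard_eq_pow_finrank (K := ZMod p) (V := D), Nat.card_zmod] at hD₁
  rw [Module.natCard_eq_pow_finrank (K := ZMod p) (V := D.dualCoannihilator),
    Nat.card_zmod] at hD₂
  rcases Nat.lt_or_ge (finrank (ZMod p) V / 2) (finrank (ZMod p) D) with hlt | hle
  · right
    exact hD₂.trans (Nat.mul_le_mul_right _ (Nat.pow_le_pow_right hp (by omega)))
  · left
    exact hD₁.trans (Nat.mul_le_mul_right _ (Nat.pow_le_pow_right hp hle))

/-- The image of a finite commutative `p`-group acting linearly on an `n`-dimensional space over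
`𝔽_p` has order at most `p ^ ⌊n²/4⌋`. -/
theorem card_le_pow_mul_card_ker {p : ℕ} [Fact p.Prime] {G : Type*} [CommGroup G] [Finite G]
    (hG : IsPGroup p G) (n : ℕ) {V : Type u} [AddCommGroup V] [Module (ZMod p) V]
    [Module.Finite (ZMod p) V] (hn : finrank (ZMod p) V = n) (ρ : Representation (ZMod p) G V) :
    Nat.card G ≤ p ^ (n ^ 2 / 4) * Nat.card ρ.ker := by
  induction n generalizing V with
  | zero =>
    have : Subsingleton V := finrank_zero_iff.1 hn
    have hker : ρ.ker = ⊤ := by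
      ext g
      simp [MonoidHom.mem_ker, Subsingleton.elim (ρ g) 1]
    simp [hker]
  | succ n ih =>
    have : Nontrivial V := nontrivial_of_finrank_pos (R := ZMod p) (by omega)
    obtain ⟨v, hv, hfix⟩ := exists_ne_zero_forall_apply_eq_self hG ρ
    rcases Nat.eq_zero_or_pos n with rfl | hpos
    · have hker : ρ.ker = ⊤ := by
        refine (Subgroup.eq_top_iff' _).2 fun g => MonoidHom.mem_ker.2 (LinearMap.ext fun x => ?_)
        obtain ⟨a, rfl⟩ := exists_smul_eq_of_finrank_eq_one hn hv x
        simp [hfix]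
      simp [hker]
    have hL : ∀ g, Submodule.span (ZMod p) {v} ≤ (Submodule.span (ZMod p) {v}).comap (ρ g) := by
      intro g
      rw [Submodule.span_singleton_le_iff_mem, Submodule.mem_comap, hfix]
      exact Submodule.mem_span_singleton_self v
    have hquot : finrank (ZMod p) (V ⧸ Submodule.span (ZMod p) {v}) = n := by
      have := Submodule.finrank_quotient_add_finrank (Submodule.span (ZMod p) {v})
      rw [finrank_span_singleton hv] at this
      omega
    have : Nontrivial (V ⧸ Submodule.span (ZMod p) {v}) :=
      nontrivial_of_finrank_pos (R := ZMod p) (by omega)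
    obtain ⟨ψ, hψ, hψfix⟩ := exists_ne_zero_forall_apply_eq_self hG (ρ.quotient _ hL).dual
    let φ : Dual (ZMod p) V := ψ ∘ₗ Submodule.mkQ _
    have hφ : φ ≠ 0 := by
      intro h
      refine hψ (LinearMap.ext fun x => ?_)
      obtain ⟨y, rfl⟩ := Submodule.mkQ_surjective _ x
      exact LinearMap.congr_fun h y
    have hφv : φ v = 0 := by
      have : Submodule.mkQ (Submodule.span (ZMod p) {v}) v = 0 :=
        (Submodule.Quotient.mk_eq_zero _).2 (Submodule.mem_span_singleton_self v)
      change ψ (Submodule.mkQ _ v) = 0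
      rw [this, map_zero]
    have hφρ : ∀ g x, φ (ρ g x) = φ x := by
      intro g x
      have := LinearMap.congr_fun (hψfix g⁻¹) (Submodule.mkQ _ x)
      rw [dual_apply, inv_inv] at this
      exact this
    have hH : ∀ g, LinearMap.ker φ ≤ (LinearMap.ker φ).comap (ρ g) := by
      intro g x hx
      rw [Submodule.mem_comap, LinearMap.mem_ker, hφρ]
      exact hx
    have hker : finrank (ZMod p) (LinearMap.ker φ) = n := by
      have := Module.Dual.finrank_ker_add_one_of_ne_zero hφ
      omega
    have h₁ := ih hquot (ρ.quotient _ hL)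
    have h₂ := ih hker (ρ.subrepresentation _ hH)
    have hexp : n ^ 2 / 4 + (n + 1) / 2 = (n + 1) ^ 2 / 4 := by
      obtain ⟨k, rfl | rfl⟩ := n.even_or_odd'
      · ring_nf
        omega
      · ring_nf
        omega
    rw [← hexp, pow_add, mul_assoc, ← hn]
    rcases card_ker_quotient_le_or_card_ker_subrepresentation_le ρ hv hφ hφv hL hH with h | h
    · exact h₁.trans (Nat.mul_le_mul_left _ h)
    · exact h₂.trans (Nat.mul_le_mul_left _ h)

end Representation

/-- Upper-bound part of the Goozeff–Barry theorem (Theorem 9.1):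
every abelian subgroup of `GL_{m+1}(𝔽_p)` whose order is a power of `p`
has order at most `p ^ ⌊(m+1)²/4⌋`. -/
theorem goozeff_barry_upper_bound (p : ℕ) [Fact p.Prime] (m : ℕ) (hm : 1 ≤ m)
    (E : Subgroup (GL (Fin (m + 1)) (ZMod p)))
    (habelian : ∀ x ∈ E, ∀ y ∈ E, x * y = y * x)
    (hppow : ∃ n : ℕ, Nat.card E = p ^ n) :
    Nat.card E ≤ p ^ ((m + 1) ^ 2 / 4) := by
  let _ : CommGroup E :=
    { (inferInstance : Group E) with
      mul_comm := fun x y => Subtype.ext (habelian x x.2 y y.2) }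
  let ρ : Representation (ZMod p) E (Fin (m + 1) → ZMod p) :=
    (Matrix.toLinAlgEquiv' : Matrix (Fin (m + 1)) (Fin (m + 1)) (ZMod p) ≃ₐ[ZMod p] _).toMonoidHom
      |>.comp ((Units.coeHom _).comp E.subtype)
  have hρ : Function.Injective ρ := fun x y h =>
    Subtype.ext (Units.ext (Matrix.toLinAlgEquiv'.injective h))
  have hG : IsPGroup p E := IsPGroup.iff_card.2 hppow
  have h := Representation.card_le_pow_mul_card_ker hG (m + 1) (by simp) ρ
  have hker : Nat.card ρ.ker = 1 := by
    rw [(MonoidHom.ker_eq_bot_iff ρ).2 hρ, Subgroup.card_bot]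
  rwa [hker, mul_one] at h
end

section
/- Let p be a prime, m ≥ 1 an integer, and set r = ⌊(m+1)/2⌋. The set H of all (m+1)×(m+1) block matrices of the form [[I_r, M],[0, I_{m+1−r}]], where M ranges over all r×(m+1−r) matrices over F_p and I_r, I_{m+1−r} are identity matrices, is a subgroup of GL_{m+1}(F_p) contained in U_m(F_p); it is isomorphic to the additive group F_p^{r(m+1−r)} (in particular it is elementary abelian, i.e., abelian with every nontrivial element of order p), and its order is p^{r(m+1−r)} = p^{⌊(m+1)²/4⌋}. (Attainment part of the Goozeff–Barry theorem, Theorem 9.1 of the paper.) -/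
/-- The `n × n` matrix whose only nonzero block is `M`, in rows `< r` and columns `≥ r`. -/
def upperRightBlock (R : Type*) [CommRing R] (r n : ℕ) :
    (Fin r → Fin (n - r) → R) →+ Matrix (Fin n) (Fin n) R where
  toFun M := Matrix.of fun i j =>
    if h : (i : ℕ) < r ∧ r ≤ (j : ℕ) then M ⟨i, h.1⟩ ⟨j - r, by omega⟩ else 0
  map_zero' := by
    ext i j
    simp
  map_add' M N := by
    ext i j
    by_cases h : (i : ℕ) < r ∧ r ≤ (j : ℕ) <;> simp [h]

section UpperRightBlock

variable {R : Type*} [CommRing R] {r n : ℕ}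

theorem upperRightBlock_apply (M : Fin r → Fin (n - r) → R) (i j : Fin n) :
    upperRightBlock R r n M i j =
      if h : (i : ℕ) < r ∧ r ≤ (j : ℕ) then M ⟨i, h.1⟩ ⟨j - r, by omega⟩ else 0 :=
  rfl

theorem upperRightBlock_mul (M N : Fin r → Fin (n - r) → R) :
    upperRightBlock R r n M * upperRightBlock R r n N = 0 := by
  ext i j
  rw [Matrix.mul_apply, Matrix.zero_apply]
  refine Finset.sum_eq_zero fun k _ => ?_
  rw [upperRightBlock_apply, upperRightBlock_apply]
  by_cases hk : (k : ℕ) < r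
  · rw [dif_neg (by omega), zero_mul]
  · rw [dif_neg (c := (k : ℕ) < r ∧ _) (by omega), mul_zero]

variable (R r n) in
/-- The homomorphism `M ↦ [[1, M], [0, 1]]` into the general linear group. -/
def upperRightUnipotent :
    Multiplicative (Fin r → Fin (n - r) → R) →* GL (Fin n) R :=
  MonoidHom.toHomUnits
    { toFun := fun M => 1 + upperRightBlock R r n M.toAdd
      map_one' := by simp
      map_mul' := fun M N => by
        rw [toAdd_mul, map_add, mul_add, add_mul, add_mul, upperRightBlock_mul]
        simp [add_assoc] }

theorem coe_upperRightUnipotent (M : Multiplicative (Fin r → Fin (n - r) → R)) :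
    (upperRightUnipotent R r n M : Matrix (Fin n) (Fin n) R) =
      1 + upperRightBlock R r n M.toAdd :=
  rfl

theorem upperRightBlock_injective (hr : r ≤ n) :
    Function.Injective (upperRightBlock R r n) := by
  intro M N h
  funext i j
  have hij := congrFun (congrFun h ⟨i, by omega⟩) ⟨r + j, by omega⟩
  simpa [upperRightBlock_apply] using hij

theorem upperRightUnipotent_injective (hr : r ≤ n) :
    Function.Injective (upperRightUnipotent R r n) := by
  intro M N h
  have h' := congrArg Units.val h
  rw [coe_upperRightUnipotent, coe_upperRightUnipotent, add_right_inj] at h'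
  exact Multiplicative.toAdd.injective (upperRightBlock_injective hr h')

theorem mem_range_upperRightUnipotent (hr : r ≤ n) (g : GL (Fin n) R) :
    g ∈ (upperRightUnipotent R r n).range ↔ ∀ i j : Fin n,
      ((i : ℕ) = (j : ℕ) → (g : Matrix (Fin n) (Fin n) R) i j = 1) ∧
      ((i : ℕ) ≠ (j : ℕ) → ¬((i : ℕ) < r ∧ r ≤ (j : ℕ)) →
        (g : Matrix (Fin n) (Fin n) R) i j = 0) := by
  constructor
  · rintro ⟨M, rfl⟩ i j
    rw [coe_upperRightUnipotent, Matrix.add_apply, upperRightBlock_apply, Matrix.one_apply]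
    constructor
    · intro h
      rw [dif_neg (by omega), if_pos (Fin.ext h), add_zero]
    · intro h h'
      rw [dif_neg h', if_neg (fun e => h (congrArg Fin.val e)), add_zero]
  · intro h
    refine ⟨Multiplicative.ofAdd fun i j =>
      (g : Matrix (Fin n) (Fin n) R) ⟨i, by omega⟩ ⟨r + j, by omega⟩, ?_⟩
    ext i j
    rw [coe_upperRightUnipotent, Matrix.add_apply, upperRightBlock_apply, Matrix.one_apply]
    by_cases hij : (i : ℕ) = j
    · rw [dif_neg (by omega), if_pos (Fin.ext hij), add_zero, (h i j).1 hij]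
    · rw [if_neg (fun e => hij (congrArg Fin.val e)), zero_add]
      split_ifs with hb
      · simp [Nat.add_sub_cancel' hb.2]
      · exact ((h i j).2 hij hb).symm

end UpperRightBlock

theorem Nat.half_mul_sub_half (n : ℕ) : n / 2 * (n - n / 2) = n ^ 2 / 4 := by
  obtain ⟨k, rfl | rfl⟩ := Nat.even_or_odd' n
  · rw [show 2 * k / 2 = k by omega, show 2 * k - k = k by omega,
      show (2 * k) ^ 2 = 4 * (k * k) by ring]
    omega
  · rw [show (2 * k + 1) / 2 = k by omega, show 2 * k + 1 - k = k + 1 by omega,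
      show (2 * k + 1) ^ 2 = 4 * (k * (k + 1)) + 1 by ring]
    omega


/-- Attainment part of the Goozeff–Barry theorem (Theorem 9.1): with
`r = ⌊(m+1)/2⌋`, the set of block matrices `[[I_r, M],[0, I_{m+1-r}]]`
(`M` an arbitrary `r × (m+1-r)` matrix over `𝔽_p`) is a subgroup of
`GL_{m+1}(𝔽_p)` contained in the unipotent upper-triangular group `U_m(𝔽_p)`,
isomorphic to the additive group `𝔽_p^{r(m+1-r)}`, of order
`p ^ (r(m+1-r)) = p ^ ⌊(m+1)²/4⌋`. -/
theorem goozeff_barry_attained (p : ℕ) [Fact p.Prime] (m : ℕ) (hm : 1 ≤ m) :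
    ∃ H : Subgroup (GL (Fin (m + 1)) (ZMod p)),
      -- the underlying set of `H` is exactly the set of block matrices
      -- `[[I_r, M],[0, I_{m+1-r}]]` with `r = ⌊(m+1)/2⌋`
      ((H : Set (GL (Fin (m + 1)) (ZMod p))) =
        {g : GL (Fin (m + 1)) (ZMod p) | ∀ i j : Fin (m + 1),
          ((i : ℕ) = (j : ℕ) →
            (g : Matrix (Fin (m + 1)) (Fin (m + 1)) (ZMod p)) i j = 1) ∧
          ((i : ℕ) ≠ (j : ℕ) → ¬((i : ℕ) < (m + 1) / 2 ∧ (m + 1) / 2 ≤ (j : ℕ)) →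
            (g : Matrix (Fin (m + 1)) (Fin (m + 1)) (ZMod p)) i j = 0)}) ∧
      -- `H` is contained in `U_m(𝔽_p)`
      (∀ g ∈ H, ∀ i j : Fin (m + 1),
        (i = j → (g : Matrix (Fin (m + 1)) (Fin (m + 1)) (ZMod p)) i j = 1) ∧
        (j < i → (g : Matrix (Fin (m + 1)) (Fin (m + 1)) (ZMod p)) i j = 0)) ∧
      -- `H` is isomorphic to the additive group `𝔽_p^{r(m+1-r)}`
      Nonempty (H ≃* Multiplicative
        (Fin ((m + 1) / 2) → Fin (m + 1 - (m + 1) / 2) → ZMod p)) ∧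
      -- the order of `H`
      Nat.card H = p ^ (((m + 1) / 2) * (m + 1 - (m + 1) / 2)) ∧
      ((m + 1) / 2) * (m + 1 - (m + 1) / 2) = (m + 1) ^ 2 / 4 := by
  have hr : (m + 1) / 2 ≤ m + 1 := Nat.div_le_self _ _
  let e := MonoidHom.ofInjective (upperRightUnipotent_injective (R := ZMod p) hr)
  refine ⟨(upperRightUnipotent (ZMod p) ((m + 1) / 2) (m + 1)).range,
    Set.ext fun g => mem_range_upperRightUnipotent hr g, fun g hg i j => ?_,
    ⟨e.symm⟩, ?_, Nat.half_mul_sub_half (m + 1)⟩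
  · have h := (mem_range_upperRightUnipotent hr g).1 hg i j
    exact ⟨fun hij => h.1 (congrArg Fin.val hij), fun hij => h.2 (by omega) (by omega)⟩
  · rw [← Nat.card_congr e.toEquiv, Nat.card_congr Multiplicative.toAdd, Nat.card_fun,
      Nat.card_fun]
    simp [← pow_mul, mul_comm]
end

section
/- Let p be a prime and m ≥ 1 an integer. Every abelian subgroup E of the unipotent upper-triangular group U_m(F_p) satisfies |E| ≤ p^{⌊(m+1)²/4⌋}. -/
open Module in
theorem finrank_add_finrank_le_of_dotProduct_eq_zero {F ι : Type*} [Field F] [Fintype ι]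
    (A B : Submodule F (ι → F)) (h : ∀ a ∈ A, ∀ b ∈ B, a ⬝ᵥ b = 0) :
    finrank F A + finrank F B ≤ Fintype.card ι := by
  classical
  have hB : B.map (dotProductEquiv F ι).toLinearMap ≤ A.dualAnnihilator := by
    rintro _ ⟨b, hb, rfl⟩
    rw [Submodule.mem_dualAnnihilator]
    intro a ha
    simpa [dotProduct_comm] using h a ha b hb
  have h₁ := Submodule.finrank_mono hB
  rw [LinearEquiv.finrank_map_eq] at h₁
  have h₂ := Subspace.finrank_add_finrank_dualAnnihilator_eq A
  rw [Module.finrank_fintype_fun_eq_card] at h₂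
  omega

open Module in
theorem Submodule.finrank_le_finrank_map_add_finrank_map {F M M' M'' : Type*} [Field F]
    [AddCommGroup M] [Module F M] [FiniteDimensional F M] [AddCommGroup M'] [Module F M']
    [AddCommGroup M''] [Module F M''] (V : Submodule F M) (f : M →ₗ[F] M') (g : M →ₗ[F] M'')
    (hfg : ∀ x ∈ V, f x = 0 → g x = 0 → x = 0) :
    finrank F V ≤ finrank F (V.map f) + finrank F ((V ⊓ LinearMap.ker f).map g) := by
  have h₁ := (f.domRestrict V).finrank_range_add_finrank_ker
  rw [LinearMap.range_domRestrict] at h₁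
  let k : LinearMap.ker (f.domRestrict V) →ₗ[F] (V ⊓ LinearMap.ker f).map g :=
    LinearMap.codRestrict _ (g ∘ₗ V.subtype ∘ₗ Submodule.subtype _) fun x =>
      ⟨x.1.1, ⟨x.1.2, x.2⟩, rfl⟩
  have hk : Function.Injective k := by
    rw [injective_iff_map_eq_zero]
    intro x hx
    exact Subtype.ext (Subtype.ext (hfg _ x.1.2 x.2 (congrArg Subtype.val hx)))
  have h₂ := LinearMap.finrank_le_finrank_of_injective hk
  omega

open Module in
/-- A commuting linear space of strictly upper-triangular `n × n` matrices has dimension at most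
`⌊n² / 4⌋`. -/
theorem finrank_le_sq_div_four_of_commute {F : Type*} [Field F] (n : ℕ)
    (V : Submodule F (Matrix (Fin n) (Fin n) F))
    (hV : ∀ M ∈ V, ∀ i j, j ≤ i → M i j = 0) (hcomm : ∀ M ∈ V, ∀ N ∈ V, M * N = N * M) :
    finrank F V ≤ n ^ 2 / 4 := by
  induction n with
  | zero => simp [Subsingleton.elim V ⊥]
  | succ n ih =>
    rcases Nat.eq_zero_or_pos n with rfl | hn
    · have : V = ⊥ := by
        rw [eq_bot_iff]
        intro M hM
        rw [Submodule.mem_bot]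
        ext i j
        exact hV M hM i j (by omega)
      simp [this]
    let f : Matrix (Fin (n + 1)) (Fin (n + 1)) F →ₗ[F] Matrix (Fin n) (Fin n) F :=
      { toFun := fun M => M.submatrix Fin.succ Fin.succ
        map_add' := fun _ _ => rfl
        map_smul' := fun _ _ => rfl }
    let g : Matrix (Fin (n + 1)) (Fin (n + 1)) F →ₗ[F] Matrix (Fin n) (Fin n) F :=
      { toFun := fun M => M.submatrix Fin.castSucc Fin.castSucc
        map_add' := fun _ _ => rfl
        map_smul' := fun _ _ => rfl }
    let row : Matrix (Fin (n + 1)) (Fin (n + 1)) F →ₗ[F] Fin (n + 1) → F :=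
      { toFun := fun M => M 0
        map_add' := fun _ _ => rfl
        map_smul' := fun _ _ => rfl }
    let col : Matrix (Fin (n + 1)) (Fin (n + 1)) F →ₗ[F] Fin (n + 1) → F :=
      { toFun := fun M i => M i (Fin.last n)
        map_add' := fun _ _ => rfl
        map_smul' := fun _ _ => rfl }
    have f_mul : ∀ M ∈ V, ∀ N, f M * f N = f (M * N) := by
      intro M hM N
      ext i j
      change ∑ k : Fin n, M i.succ k.succ * N k.succ j.succ = (M * N) i.succ j.succ
      simp [Matrix.mul_apply, Fin.sum_univ_succ, hV M hM i.succ 0 (Fin.zero_le _)]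
    have g_mul : ∀ M, ∀ N ∈ V, g M * g N = g (M * N) := by
      intro M N hN
      ext i j
      change ∑ k : Fin n, M i.castSucc k.castSucc * N k.castSucc j.castSucc =
        (M * N) i.castSucc j.castSucc
      simp [Matrix.mul_apply, Fin.sum_univ_castSucc,
        hV N hN (Fin.last n) j.castSucc (Fin.le_last _)]
    have hf : finrank F (V.map f) ≤ n ^ 2 / 4 := by
      apply ih
      · rintro _ ⟨M, hM, rfl⟩ i j hij
        exact hV M hM _ _ (Fin.succ_le_succ_iff.2 hij)
      · rintro _ ⟨M, hM, rfl⟩ _ ⟨N, hN, rfl⟩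
        rw [f_mul M hM, f_mul N hN, hcomm M hM N hN]
    have hg : finrank F (V.map g) ≤ n ^ 2 / 4 := by
      apply ih
      · rintro _ ⟨M, hM, rfl⟩ i j hij
        exact hV M hM _ _ (Fin.castSucc_le_castSucc_iff.2 hij)
      · rintro _ ⟨M, hM, rfl⟩ _ ⟨N, hN, rfl⟩
        rw [g_mul M N hN, g_mul N M hM, hcomm M hM N hN]
    have hfrow := V.finrank_le_finrank_map_add_finrank_map f row (by
      intro M hM h₁ h₂
      ext i j
      cases i using Fin.cases with
      | zero => exact congrFun h₂ j
      | succ i =>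
        cases j using Fin.cases with
        | zero => exact hV M hM _ _ (Fin.zero_le _)
        | succ j => exact congrFun (congrFun h₁ i) j)
    have hgcol := V.finrank_le_finrank_map_add_finrank_map g col (by
      intro M hM h₁ h₂
      ext i j
      cases j using Fin.lastCases with
      | last => exact congrFun h₂ i
      | cast j =>
        cases i using Fin.lastCases with
        | last => exact hV M hM _ _ (Fin.le_last _)
        | cast i => exact congrFun (congrFun h₁ i) j)
    have hsum := finrank_add_finrank_le_of_dotProduct_eq_zero
      ((V ⊓ LinearMap.ker f).map row) ((V ⊓ LinearMap.ker g).map col) (by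
        rintro _ ⟨M, ⟨hM, hfM⟩, rfl⟩ _ ⟨N, ⟨hN, hgN⟩, rfl⟩
        have hNM : (N * M) 0 (Fin.last n) = 0 := by
          rw [Matrix.mul_apply]
          refine Finset.sum_eq_zero fun k _ => ?_
          cases k using Fin.lastCases with
          | last => rw [hV M hM _ _ le_rfl, mul_zero]
          | cast k =>
            have h : N (Fin.castSucc ⟨0, hn⟩) k.castSucc = 0 :=
              congrFun (congrFun hgN ⟨0, hn⟩) k
            rw [show (0 : Fin (n + 1)) = Fin.castSucc ⟨0, hn⟩ from rfl, h, zero_mul]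
        rw [← hcomm M hM N hN] at hNM
        exact hNM)
    rw [Fintype.card_fin] at hsum
    have harith : n ^ 2 / 4 + (n + 1) / 2 = (n + 1) ^ 2 / 4 := by
      obtain ⟨k, rfl | rfl⟩ := n.even_or_odd'
      · have h₁ : (2 * k) ^ 2 = 4 * (k * k) := by ring
        have h₂ : (2 * k + 1) ^ 2 = 4 * (k * k) + 4 * k + 1 := by ring
        omega
      · have h₁ : (2 * k + 1) ^ 2 = 4 * (k * k) + 4 * k + 1 := by ring
        have h₂ : (2 * k + 1 + 1) ^ 2 = 4 * (k * k) + 8 * k + 4 := by ring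
        omega
    omega

/-- Every abelian subgroup of the unipotent upper-triangular group `U_m(𝔽_p)`
(realized as a subgroup of `GL_{m+1}(𝔽_p)` all of whose elements are unipotent
upper-triangular matrices) has order at most `p ^ ⌊(m+1)²/4⌋`. -/
theorem abelian_subgroup_unipotent_card_le (p : ℕ) [Fact p.Prime] (m : ℕ) (hm : 1 ≤ m)
    (E : Subgroup (GL (Fin (m + 1)) (ZMod p)))
    (hunip : ∀ g ∈ E, ∀ i j : Fin (m + 1),
      (i = j → (g : Matrix (Fin (m + 1)) (Fin (m + 1)) (ZMod p)) i j = 1) ∧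
      (j < i → (g : Matrix (Fin (m + 1)) (Fin (m + 1)) (ZMod p)) i j = 0))
    (habelian : ∀ x ∈ E, ∀ y ∈ E, x * y = y * x) :
    Nat.card E ≤ p ^ ((m + 1) ^ 2 / 4) := by
  let S : Set (Matrix (Fin (m + 1)) (Fin (m + 1)) (ZMod p)) :=
    {M | ∃ g ∈ E, M = (g : Matrix (Fin (m + 1)) (Fin (m + 1)) (ZMod p)) - 1}
  let V := Submodule.span (ZMod p) S
  have hV : ∀ M ∈ V, ∀ i j, j ≤ i → M i j = 0 := by
    intro M hM i j hij
    induction hM using Submodule.span_induction with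
    | mem M hM =>
      obtain ⟨g, hg, rfl⟩ := hM
      rcases hij.eq_or_lt with rfl | h
      · simp [(hunip g hg j j).1 rfl]
      · simp [(hunip g hg i j).2 h, h.ne']
    | zero => rfl
    | add M N _ _ hM hN => simp [hM, hN]
    | smul c M _ hM => simp [hM]
  have hcomm : ∀ M ∈ V, ∀ N ∈ V, M * N = N * M := by
    intro M hM N hN
    induction hM, hN using Submodule.span_induction₂ with
    | mem_mem M N hM hN =>
      obtain ⟨g, hg, rfl⟩ := hM
      obtain ⟨h, hh, rfl⟩ := hN
      have hgh := congrArg Units.val (habelian g hg h hh)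
      rw [Units.val_mul, Units.val_mul] at hgh
      rw [sub_mul, mul_sub, mul_sub, sub_mul, mul_sub, mul_sub, hgh]
      simp only [one_mul, mul_one]
      abel
    | zero_left N _ => simp
    | zero_right M _ => simp
    | add_left M N P _ _ _ h₁ h₂ => rw [add_mul, mul_add, h₁, h₂]
    | add_right M N P _ _ _ h₁ h₂ => rw [add_mul, mul_add, h₁, h₂]
    | smul_left c M N _ _ h => rw [smul_mul_assoc, mul_smul_comm, h]
    | smul_right c M N _ _ h => rw [smul_mul_assoc, mul_smul_comm, h]
  let ι : E → V := fun g => ⟨(g : GL (Fin (m + 1)) (ZMod p)) - 1,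
    Submodule.subset_span ⟨g, g.2, rfl⟩⟩
  have hι : Function.Injective ι := by
    intro g h hgh
    exact Subtype.ext (Units.ext (sub_left_injective (congrArg Subtype.val hgh)))
  calc Nat.card E ≤ Nat.card V := Nat.card_le_card_of_injective ι hι
    _ = p ^ Module.finrank (ZMod p) V := by
      rw [Module.natCard_eq_pow_finrank (K := ZMod p), Nat.card_zmod]
    _ ≤ p ^ ((m + 1) ^ 2 / 4) := Nat.pow_le_pow_right (Fact.out : p.Prime).pos
      (finrank_le_sq_div_four_of_commute _ V hV hcomm)
end
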